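/- Let c ≥ 2 be an integer and C = {1, 2c}. Then G_C(2c) XOR G_C(12c) = 6, G_C(4c) XOR G_C(10c) = 6, and G_C(6c) XOR G_C(8c) = 6. -/

import Mathlib

/-- The minimum excludant of a set of naturals. -/
noncomputable def mex (S : Set ℕ) : ℕ := sInf {v | v ∉ S}

/-- Fueled auxiliary for the Grundy sequence of CUT with cut-set `C`. -/
noncomputable def cutGAux (C : Finset ℕ) : ℕ → ℕ → ℕ
  | 0, _ => 0
  | fuel + 1, n =>
      mex {v | ∃ d ∈ C, ∃ l : List ℕ, l.length = d + 1 ∧ (∀ x ∈ l, 0 < x) ∧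
            l.sum = n ∧ (l.map (cutGAux C fuel)).foldr (· ^^^ ·) 0 = v}

/-- The Grundy (nim-value) sequence of the game CUT with cut-set `C`. -/
noncomputable def cutG (C : Finset ℕ) (n : ℕ) : ℕ := cutGAux C n n

/-- The nim-value of an option (a tuple of pile sizes). -/
noncomputable def nimVal (C : Finset ℕ) (l : List ℕ) : ℕ :=
  (l.map (cutG C)).foldr (· ^^^ ·) 0

/-- The value of a pile of size `e + 1` in the game CUT with cut-set `{1, 2 * c}`, for
`e < 12 * c`. -/
def pileVal (c e : ℕ) : ℕ :=
  if e < 2 * c then e % 2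
  else if e < 4 * c then 2 + e % 2
  else if e = 4 * c then 1
  else if e < 6 * c then 5 - e % 2
  else if e < 8 * c then 3 - e % 2
  else if e < 10 * c then 4 + e % 2
  else 6 + e % 2

lemma pileVal_cases (c e : ℕ) :
    (e < 2 * c ∧ e % 2 = 0 ∧ pileVal c e = 0) ∨
    (e < 2 * c ∧ e % 2 = 1 ∧ pileVal c e = 1) ∨
    (2 * c ≤ e ∧ e < 4 * c ∧ e % 2 = 0 ∧ pileVal c e = 2) ∨
    (2 * c ≤ e ∧ e < 4 * c ∧ e % 2 = 1 ∧ pileVal c e = 3) ∨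
    (e = 4 * c ∧ pileVal c e = 1) ∨
    (4 * c < e ∧ e < 6 * c ∧ e % 2 = 0 ∧ pileVal c e = 5) ∨
    (4 * c < e ∧ e < 6 * c ∧ e % 2 = 1 ∧ pileVal c e = 4) ∨
    (6 * c ≤ e ∧ e < 8 * c ∧ e % 2 = 0 ∧ pileVal c e = 3) ∨
    (6 * c ≤ e ∧ e < 8 * c ∧ e % 2 = 1 ∧ pileVal c e = 2) ∨
    (8 * c ≤ e ∧ e < 10 * c ∧ e % 2 = 0 ∧ pileVal c e = 4) ∨
    (8 * c ≤ e ∧ e < 10 * c ∧ e % 2 = 1 ∧ pileVal c e = 5) ∨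
    (10 * c ≤ e ∧ e % 2 = 0 ∧ pileVal c e = 6) ∨
    (10 * c ≤ e ∧ e % 2 = 1 ∧ pileVal c e = 7) := by
  unfold pileVal
  rcases Nat.mod_two_eq_zero_or_one e with h | h <;> simp only [h] <;> split_ifs <;> simp <;> omega

/-- A necessary condition for piles with sizes `eᵢ + 1` and `∑ eᵢ = e` to have nim-sum `v`. -/
def Feasible (c e v : ℕ) : Prop :=
  v < 8 ∧
  ((v + e) % 2 = 0 → (v / 2 = 1 → 2 * c ≤ e) ∧ (v / 2 = 2 → 8 * c ≤ e) ∧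
    (v / 2 = 3 → 10 * c ≤ e)) ∧
  ((v + e) % 2 = 1 → (v / 2 = 0 → 4 * c ≤ e) ∧ (v / 2 = 1 → 6 * c ≤ e) ∧
    (v / 2 = 2 → 4 * c < e) ∧ (v / 2 = 3 → 6 * c < e))

lemma feasible_pileVal (c e : ℕ) : Feasible c e (pileVal c e) := by
  unfold Feasible
  rcases pileVal_cases c e with h | h | h | h | h | h | h | h | h | h | h | h | h <;> omega

set_option maxHeartbeats 1000000 in
lemma Feasible.add {c e₁ e₂ v₁ v₂ : ℕ} (hc : 0 < c) (h₁ : Feasible c e₁ v₁)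
    (h₂ : Feasible c e₂ v₂) : Feasible c (e₁ + e₂) (v₁ ^^^ v₂) := by
  unfold Feasible at *
  obtain ⟨hv₁, h₁⟩ := h₁
  obtain ⟨hv₂, h₂⟩ := h₂
  interval_cases v₁ <;> simp at h₁ <;> interval_cases v₂ <;> simp at h₂ ⊢ <;> omega

lemma feasible_list {c : ℕ} (hc : 0 < c) (l : List ℕ) (hl : ∀ x ∈ l, 0 < x) :
    ∃ e, e + l.length = l.sum ∧
      Feasible c e ((l.map fun h => pileVal c (h - 1)).foldr (· ^^^ ·) 0) := by
  induction l with
  | nil => exact ⟨0, rfl, by simp [Feasible]⟩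
  | cons x l ih =>
    obtain ⟨e, he, hf⟩ := ih fun y hy => hl y (List.mem_cons_of_mem _ hy)
    have hx := hl x List.mem_cons_self
    refine ⟨(x - 1) + e, ?_, (feasible_pileVal c (x - 1)).add hc hf⟩
    simp only [List.length_cons, List.sum_cons]
    omega

lemma not_feasible_pileVal {c e : ℕ} (he : e + 2 * c < 12 * c) :
    ¬ Feasible c e (pileVal c (e + 2 * c)) := by
  unfold Feasible
  rcases pileVal_cases c (e + 2 * c) with h | h | h | h | h | h | h | h | h | h | h | h | h <;>
    omega

set_option maxHeartbeats 1000000 in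
lemma pileVal_xor_ne {c e₁ e₂ : ℕ} (he : e₁ + e₂ + 1 < 12 * c) :
    pileVal c e₁ ^^^ pileVal c e₂ ≠ pileVal c (e₁ + e₂ + 1) := by
  have h := pileVal_cases c (e₁ + e₂ + 1)
  generalize pileVal c (e₁ + e₂ + 1) = w at h
  have h₁ := pileVal_cases c e₁
  generalize pileVal c e₁ = w₁ at h₁
  have h₂ := pileVal_cases c e₂
  generalize pileVal c e₂ = w₂ at h₂
  rcases h₁ with
    h₁ | h₁ | h₁ | h₁ | h₁ | h₁ | h₁ | h₁ | h₁ | h₁ | h₁ | h₁ | h₁ <;>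
  rcases h₂ with
    h₂ | h₂ | h₂ | h₂ | h₂ | h₂ | h₂ | h₂ | h₂ | h₂ | h₂ | h₂ | h₂ <;>
  first
  | omega
  | (simp only [h₁, h₂, Nat.reduceXor]
     omega)

/-- The set of values of the options of a pile of size `n`, computed from `pileVal`. -/
def optionVals (c n : ℕ) : Set ℕ :=
  {v | ∃ d ∈ ({1, 2 * c} : Finset ℕ), ∃ l : List ℕ, l.length = d + 1 ∧ (∀ x ∈ l, 0 < x) ∧
    l.sum = n ∧ (l.map fun h => pileVal c (h - 1)).foldr (· ^^^ ·) 0 = v}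

lemma pileVal_notMem_optionVals {c e : ℕ} (he : e < 12 * c) :
    pileVal c e ∉ optionVals c (e + 1) := by
  rintro ⟨d, hd, l, hlen, hpos, hsum, hv⟩
  simp only [Finset.mem_insert, Finset.mem_singleton] at hd
  rcases hd with rfl | rfl
  · obtain ⟨x, y, rfl⟩ := List.length_eq_two.mp hlen
    have hx := hpos x (by simp)
    have hy := hpos y (by simp)
    simp only [List.sum_cons, List.sum_nil] at hsum
    have hxy : e = (x - 1) + (y - 1) + 1 := by omega
    subst hxy
    exact pileVal_xor_ne he (by simpa using hv)
  · obtain ⟨e', he', hf⟩ := feasible_list (c := c) (by omega) l hpos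
    have hee : e = e' + 2 * c := by omega
    subst hee
    rw [hv] at hf
    exact not_feasible_pileVal he hf

lemma mem_optionVals_of_pair {c e v : ℕ} (e₁ e₂ : ℕ) (he : e₁ + e₂ + 1 = e)
    (hv : pileVal c e₁ ^^^ pileVal c e₂ = v) : v ∈ optionVals c (e + 1) := by
  refine ⟨1, by simp, [e₁ + 1, e₂ + 1], rfl, by simp, ?_, by simpa using hv⟩
  simp only [List.sum_cons, List.sum_nil]
  omega

lemma foldr_xor_replicate_zero (k : ℕ) : (List.replicate k 0).foldr (· ^^^ ·) 0 = 0 := by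
  induction k with
  | zero => rfl
  | succ k ih => simp [List.replicate_succ, ih]

lemma mem_optionVals_of_list {c e v : ℕ} (hc : 0 < c) (l : List ℕ) (hl : l.length ≤ 2 * c + 1)
    (he : l.sum + 2 * c = e) (hv : (l.map (pileVal c)).foldr (· ^^^ ·) 0 = v) :
    v ∈ optionVals c (e + 1) := by
  have hsum : ∀ l : List ℕ, (l.map (· + 1)).sum = l.sum + l.length := by
    intro l
    induction l with
    | nil => rfl
    | cons x l ih => simp only [List.map_cons, List.sum_cons, List.length_cons, ih]; omega
  refine ⟨2 * c, by simp, (l ++ List.replicate (2 * c + 1 - l.length) 0).map (· + 1),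
    ?_, ?_, ?_, ?_⟩
  · simp only [List.length_map, List.length_append, List.length_replicate]
    omega
  · intro x hx
    obtain ⟨y, -, rfl⟩ := List.mem_map.mp hx
    omega
  · rw [hsum]
    simp only [List.sum_append, List.sum_replicate, List.length_append, List.length_replicate,
      smul_zero]
    omega
  · have h0 : pileVal c 0 = 0 := by simp [pileVal, hc]
    have hcomp : ((fun h => pileVal c (h - 1)) ∘ fun x => x + 1) = pileVal c := by
      funext x
      simp
    rw [List.map_map, hcomp, List.map_append, List.map_replicate, h0, List.foldr_append,
      foldr_xor_replicate_zero, hv]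

lemma mem_optionVals_of_lt {c e v : ℕ} (hc : 2 ≤ c) (he : e < 12 * c) (hv : v < pileVal c e) :
    v ∈ optionVals c (e + 1) := by
  have hc0 : 0 < c := by omega
  have h0 : pileVal c 0 = 0 := by have := pileVal_cases c 0; omega
  have h1 : pileVal c 1 = 1 := by have := pileVal_cases c 1; omega
  have h2' : pileVal c (2 * c - 1) = 1 := by have := pileVal_cases c (2 * c - 1); omega
  have h2 : pileVal c (2 * c) = 2 := by have := pileVal_cases c (2 * c); omega
  have h4 : pileVal c (4 * c) = 1 := by have := pileVal_cases c (4 * c); omega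
  have h6 : pileVal c (6 * c) = 3 := by have := pileVal_cases c (6 * c); omega
  have list := fun v l hl he hv => mem_optionVals_of_list (c := c) (e := e) (v := v) hc0 l hl he hv
  have pair := fun v e₁ e₂ he hv => mem_optionVals_of_pair (c := c) (e := e) (v := v) e₁ e₂ he hv
  have hw := pileVal_cases c e
  generalize pileVal c e = w at hv hw
  rcases hw with h | h | h | h | h | h | h | h | h | h | h | h | h
  · omega
  · obtain rfl : v = 0 := by omega
    have hp : pileVal c (e - 1) = 0 := by have := pileVal_cases c (e - 1); omega
    exact pair _ (e - 1) 0 (by omega) (by simp [hp, h0])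
  · obtain ⟨j, rfl⟩ : ∃ j, e = 2 * c + j := ⟨e - 2 * c, by omega⟩
    have hj : pileVal c j = 0 := by have := pileVal_cases c j; omega
    have : v < 2 := by omega
    interval_cases v
    · exact list _ [j] (by simp) (by simp; omega) (by simp [*])
    · exact pair _ (2 * c - 1) j (by omega) (by simp [*])
  · obtain ⟨j, rfl⟩ : ∃ j, e = 2 * c + j := ⟨e - 2 * c, by omega⟩
    have hj : pileVal c j = 1 := by have := pileVal_cases c j; omega
    have hp : pileVal c (2 * c + j - 1) = 2 := by
      have := pileVal_cases c (2 * c + j - 1); omega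
    have : v < 3 := by omega
    interval_cases v
    · exact pair _ (2 * c - 1) j (by omega) (by simp [*])
    · exact list _ [j] (by simp) (by simp; omega) (by simp [*])
    · exact pair _ (2 * c + j - 1) 0 (by omega) (by simp [*])
  · obtain rfl : v = 0 := by omega
    exact list _ [2 * c - 1, 1] (by simp; omega) (by simp; omega) (by simp [*])
  · obtain ⟨j, rfl⟩ : ∃ j, e = 4 * c + j := ⟨e - 4 * c, by omega⟩
    have hj : pileVal c (j + 1) = 1 := by have := pileVal_cases c (j + 1); omega
    have hj2 : pileVal c (2 * c + j) = 2 := by have := pileVal_cases c (2 * c + j); omega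
    have hj2' : pileVal c (2 * c + j - 1) = 3 := by
      have := pileVal_cases c (2 * c + j - 1); omega
    have hp : pileVal c (4 * c + j - 1) = 4 := by
      have := pileVal_cases c (4 * c + j - 1); omega
    have : v < 5 := by omega
    interval_cases v
    · exact list _ [2 * c - 1, j + 1] (by simp; omega) (by simp; omega) (by simp [*])
    · exact pair _ (2 * c + j - 1) (2 * c) (by omega) (by simp [*])
    · exact list _ [2 * c + j] (by simp) (by simp; omega) (by simp [*])
    · exact pair _ (2 * c - 1) (2 * c + j) (by omega) (by simp [*])
    · exact pair _ (4 * c + j - 1) 0 (by omega) (by simp [*])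
  · obtain ⟨j, rfl⟩ : ∃ j, e = 4 * c + j := ⟨e - 4 * c, by omega⟩
    have hj : pileVal c j = 1 := by have := pileVal_cases c j; omega
    have hj2 : pileVal c (2 * c + j) = 3 := by have := pileVal_cases c (2 * c + j); omega
    have hj2' : pileVal c (2 * c + j - 1) = 2 := by
      have := pileVal_cases c (2 * c + j - 1); omega
    have : v < 4 := by omega
    interval_cases v
    · exact pair _ (2 * c + j - 1) (2 * c) (by omega) (by simp [*])
    · exact list _ [2 * c - 1, 1, j] (by simp; omega) (by simp; omega) (by simp [*])
    · exact pair _ (2 * c - 1) (2 * c + j) (by omega) (by simp [*])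
    · exact list _ [2 * c + j] (by simp) (by simp; omega) (by simp [*])
  · obtain ⟨j, rfl⟩ : ∃ j, e = 6 * c + j := ⟨e - 6 * c, by omega⟩
    have hj : pileVal c j = 0 := by have := pileVal_cases c j; omega
    have : v < 3 := by omega
    interval_cases v
    · exact list _ [2 * c - 1, 2 * c - 1, 1, 1, j] (by simp; omega) (by simp; omega) (by simp [*])
    · exact list _ [4 * c, j] (by simp; omega) (by simp; omega) (by simp [*])
    · exact list _ [2 * c, 2 * c - 1, 1, j] (by simp; omega) (by simp; omega) (by simp [*])
  · obtain ⟨j, rfl⟩ : ∃ j, e = 6 * c + j := ⟨e - 6 * c, by omega⟩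
    have hj : pileVal c j = 1 := by have := pileVal_cases c j; omega
    have : v < 2 := by omega
    interval_cases v
    · exact list _ [4 * c, j] (by simp; omega) (by simp; omega) (by simp [*])
    · exact list _ [2 * c, 2 * c, j] (by simp; omega) (by simp; omega) (by simp [*])
  · obtain ⟨j, rfl⟩ : ∃ j, e = 8 * c + j := ⟨e - 8 * c, by omega⟩
    have hj : pileVal c j = 0 := by have := pileVal_cases c j; omega
    have : v < 4 := by omega
    interval_cases v
    · exact list _ [2 * c, 2 * c, 2 * c - 1, 1, j] (by simp; omega) (by simp; omega) (by simp [*])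
    · exact list _ [4 * c, 2 * c - 1, 1, j] (by simp; omega) (by simp; omega) (by simp [*])
    · exact list _ [2 * c, 2 * c, 2 * c, j] (by simp; omega) (by simp; omega) (by simp [*])
    · exact list _ [4 * c, 2 * c, j] (by simp; omega) (by simp; omega) (by simp [*])
  · obtain ⟨j, rfl⟩ : ∃ j, e = 8 * c + j := ⟨e - 8 * c, by omega⟩
    have hj : pileVal c j = 1 := by have := pileVal_cases c j; omega
    have hp : pileVal c (8 * c + j - 1) = 4 := by
      have := pileVal_cases c (8 * c + j - 1); omega
    have : v < 5 := by omega
    interval_cases v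
    · exact list _ [4 * c, 2 * c - 1, 1, j] (by simp; omega) (by simp; omega) (by simp [*])
    · exact list _ [2 * c, 2 * c, 2 * c - 1, 1, j] (by simp; omega) (by simp; omega) (by simp [*])
    · exact list _ [4 * c, 2 * c, j] (by simp; omega) (by simp; omega) (by simp [*])
    · exact list _ [2 * c, 2 * c, 2 * c, j] (by simp; omega) (by simp; omega) (by simp [*])
    · exact pair _ (8 * c + j - 1) 0 (by omega) (by simp [*])
  · obtain ⟨j, rfl⟩ : ∃ j, e = 10 * c + j := ⟨e - 10 * c, by omega⟩
    have hj : pileVal c j = 0 := by have := pileVal_cases c j; omega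
    have hj2 : pileVal c (2 * c + j) = 2 := by have := pileVal_cases c (2 * c + j); omega
    have hj8 : pileVal c (8 * c + j) = 4 := by have := pileVal_cases c (8 * c + j); omega
    have : v < 6 := by omega
    interval_cases v
    · exact list _ [4 * c, 4 * c, j] (by simp; omega) (by simp; omega) (by simp [*])
    · exact list _ [4 * c, 2 * c, 2 * c, j] (by simp; omega) (by simp; omega) (by simp [*])
    · exact list _ [2 * c, 2 * c, 2 * c + j, 2 * c - 1, 1] (by simp; omega) (by simp; omega)
        (by simp [*])
    · exact list _ [6 * c, 2 * c - 1, 1, j] (by simp; omega) (by simp; omega) (by simp [*])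
    · exact list _ [8 * c + j] (by simp) (by simp; omega) (by simp [*])
    · exact pair _ (8 * c + j) (2 * c - 1) (by omega) (by simp [*])
  · obtain ⟨j, rfl⟩ : ∃ j, e = 10 * c + j := ⟨e - 10 * c, by omega⟩
    have hj : pileVal c j = 1 := by have := pileVal_cases c j; omega
    have hj2 : pileVal c (2 * c + j) = 3 := by have := pileVal_cases c (2 * c + j); omega
    have hj8 : pileVal c (8 * c + j) = 5 := by have := pileVal_cases c (8 * c + j); omega
    have hp : pileVal c (10 * c + j - 1) = 6 := by
      have := pileVal_cases c (10 * c + j - 1); omega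
    have : v < 7 := by omega
    interval_cases v
    · exact list _ [4 * c, 2 * c, 2 * c, j] (by simp; omega) (by simp; omega) (by simp [*])
    · exact list _ [4 * c, 4 * c, j] (by simp; omega) (by simp; omega) (by simp [*])
    · exact list _ [6 * c, 2 * c - 1, 1, j] (by simp; omega) (by simp; omega) (by simp [*])
    · exact list _ [2 * c, 2 * c, 2 * c + j, 2 * c - 1, 1] (by simp; omega) (by simp; omega)
        (by simp [*])
    · exact pair _ (8 * c + j) (2 * c - 1) (by omega) (by simp [*])
    · exact list _ [8 * c + j] (by simp) (by simp; omega) (by simp [*])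
    · exact pair _ (10 * c + j - 1) 0 (by omega) (by simp [*])

lemma mex_eq {S : Set ℕ} {k : ℕ} (hk : k ∉ S) (h : ∀ v < k, v ∈ S) : mex S = k :=
  le_antisymm (Nat.sInf_le hk)
    (le_csInf ⟨k, hk⟩ fun v hv => not_lt.mp fun hlt => hv (h v hlt))

lemma mex_optionVals {c e : ℕ} (hc : 2 ≤ c) (he : e < 12 * c) :
    mex (optionVals c (e + 1)) = pileVal c e :=
  mex_eq (pileVal_notMem_optionVals he) fun _ hv => mem_optionVals_of_lt hc he hv

lemma add_length_le_sum_add_one {l : List ℕ} (hl : ∀ x ∈ l, 0 < x) :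
    ∀ x ∈ l, x + l.length ≤ l.sum + 1 := by
  induction l with
  | nil => simp
  | cons y l ih =>
    have hl' : ∀ x ∈ l, 0 < x := fun x hx => hl x (List.mem_cons_of_mem _ hx)
    have hy := hl y List.mem_cons_self
    have hlen : l.length ≤ l.sum := List.length_le_sum_of_one_le l hl'
    intro x hx
    simp only [List.length_cons, List.sum_cons]
    rcases List.mem_cons.mp hx with rfl | hx
    · omega
    · have := ih hl' x hx
      omega

lemma cutGAux_eq_pileVal {c : ℕ} (hc : 2 ≤ c) (fuel n : ℕ) (hn : 0 < n) (hnf : n ≤ fuel)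
    (hn' : n ≤ 12 * c) : cutGAux {1, 2 * c} fuel n = pileVal c (n - 1) := by
  induction fuel generalizing n with
  | zero => omega
  | succ fuel ih =>
    obtain ⟨e, rfl⟩ : ∃ e, n = e + 1 := ⟨n - 1, by omega⟩
    rw [Nat.add_sub_cancel, ← mex_optionVals hc (by omega), cutGAux]
    congr 1
    ext v
    have key : ∀ d ∈ ({1, 2 * c} : Finset ℕ), ∀ l : List ℕ, l.length = d + 1 →
        (∀ x ∈ l, 0 < x) → l.sum = e + 1 →
        l.map (cutGAux {1, 2 * c} fuel) = l.map fun h => pileVal c (h - 1) := by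
      intro d hd l hlen hpos hsum
      refine List.map_congr_left fun x hx => ?_
      have hle := add_length_le_sum_add_one hpos x hx
      have hd' : 1 ≤ d := by
        simp only [Finset.mem_insert, Finset.mem_singleton] at hd
        omega
      exact ih x (hpos x hx) (by omega) (by omega)
    constructor
    · rintro ⟨d, hd, l, hlen, hpos, hsum, hv⟩
      exact ⟨d, hd, l, hlen, hpos, hsum, by rw [← key d hd l hlen hpos hsum, hv]⟩
    · rintro ⟨d, hd, l, hlen, hpos, hsum, hv⟩
      exact ⟨d, hd, l, hlen, hpos, hsum, by rw [key d hd l hlen hpos hsum, hv]⟩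

lemma cutG_eq_pileVal {c n : ℕ} (hc : 2 ≤ c) (hn : 0 < n) (hn' : n ≤ 12 * c) :
    cutG {1, 2 * c} n = pileVal c (n - 1) :=
  cutGAux_eq_pileVal hc n n hn le_rfl hn'

/-- Observation (ob2): the nim-sums of the values at the ends of paired rows of
the first period are all `6`. -/
theorem cut_ob2 (c : ℕ) (hc : 2 ≤ c) :
    cutG {1, 2*c} (2*c) ^^^ cutG {1, 2*c} (12*c) = 6 ∧
    cutG {1, 2*c} (4*c) ^^^ cutG {1, 2*c} (10*c) = 6 ∧
    cutG {1, 2*c} (6*c) ^^^ cutG {1, 2*c} (8*c) = 6 := by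
  have val : ∀ n k, 0 < n → n ≤ 12 * c → pileVal c (n - 1) = k → cutG {1, 2 * c} n = k :=
    fun n k hn hn' h => (cutG_eq_pileVal hc hn hn').trans h
  have h2 : cutG {1, 2 * c} (2 * c) = 1 := val _ _ (by omega) (by omega) (by
    have := pileVal_cases c (2 * c - 1)
    omega)
  have h4 : cutG {1, 2 * c} (4 * c) = 3 := val _ _ (by omega) (by omega) (by
    have := pileVal_cases c (4 * c - 1)
    omega)
  have h6 : cutG {1, 2 * c} (6 * c) = 4 := val _ _ (by omega) (by omega) (by
    have := pileVal_cases c (6 * c - 1)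
    omega)
  have h8 : cutG {1, 2 * c} (8 * c) = 2 := val _ _ (by omega) (by omega) (by
    have := pileVal_cases c (8 * c - 1)
    omega)
  have h10 : cutG {1, 2 * c} (10 * c) = 5 := val _ _ (by omega) (by omega) (by
    have := pileVal_cases c (10 * c - 1)
    omega)
  have h12 : cutG {1, 2 * c} (12 * c) = 7 := val _ _ (by omega) (by omega) (by
    have := pileVal_cases c (12 * c - 1)
    omega)
  simp [h2, h4, h6, h8, h10, h12]
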